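/- arXiv:1807.03525 — 4 statements merged into one kernel-verified Lean document; each statement's English description precedes it below -/
import Mathlib

section
/- If n ≥ 4 and n ≡ 2, 3, 4, 6 or 10 (mod 15), then the largest minimum weight among all binary LCD [n,4] codes equals ⌊8n/15⌋ − 1. -/
/-- The (Hamming) weight of a vector over `F_2`. -/
def wt {n : ℕ} (x : Fin n → ZMod 2) : ℕ :=
  Finset.card (Finset.univ.filter fun i => x i ≠ 0)

/-- The dual code of a binary code `C`, with respect to the standard inner product. -/
def dualCode {n : ℕ} (C : Submodule (ZMod 2) (Fin n → ZMod 2)) :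
    Submodule (ZMod 2) (Fin n → ZMod 2) where
  carrier := {x | ∀ y ∈ C, ∑ i, x i * y i = 0}
  add_mem' := by
    intro a b ha hb y hy
    simp [Pi.add_apply, add_mul, Finset.sum_add_distrib, ha y hy, hb y hy]
  zero_mem' := by
    intro y hy
    simp
  smul_mem' := by
    intro c a ha y hy
    simp only [Pi.smul_apply, smul_eq_mul, mul_assoc, ← Finset.mul_sum, ha y hy, mul_zero]

/-- A binary code is linear complementary dual (LCD) if it meets its dual trivially. -/
def IsLCD {n : ℕ} (C : Submodule (ZMod 2) (Fin n → ZMod 2)) : Prop :=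
  C ⊓ dualCode C = ⊥

/-- The minimum weight of a binary code: the smallest weight of a nonzero codeword. -/
noncomputable def minWt {n : ℕ} (C : Submodule (ZMod 2) (Fin n → ZMod 2)) : ℕ :=
  sInf {w | ∃ x ∈ C, x ≠ 0 ∧ wt x = w}

/-- `dLCD n k` is the largest minimum weight among all binary LCD `[n,k]` codes. -/
noncomputable def dLCD (n k : ℕ) : ℕ :=
  sSup {d | ∃ C : Submodule (ZMod 2) (Fin n → ZMod 2),
    Module.finrank (ZMod 2) C = k ∧ IsLCD C ∧ minWt C = d}

/-- The number of coordinates at which some word of the list is nonzero. -/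
def jointWt {n : ℕ} (l : List (Fin n → ZMod 2)) : ℕ :=
  Finset.card (Finset.univ.filter fun i => ∃ x ∈ l, x i ≠ 0)

theorem jointWt_le {n : ℕ} (l : List (Fin n → ZMod 2)) : jointWt l ≤ n :=
  (Finset.card_le_univ _).trans_eq (Fintype.card_fin n)

/-- Each coordinate in the joint support of `x, y` lies in the support of exactly two of the
three nonzero words of their span. -/
theorem two_mul_jointWt_pair {n : ℕ} (x y : Fin n → ZMod 2) :
    2 * jointWt [x, y] = wt x + wt y + wt (x + y) := by
  simp only [jointWt, wt, Finset.card_filter, Finset.mul_sum, ← Finset.sum_add_distrib]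
  refine Finset.sum_congr rfl fun i _ => ?_
  simp only [List.mem_cons, List.not_mem_nil, or_false, exists_eq_or_imp, exists_eq_left,
    Pi.add_apply]
  have key : ∀ a b : ZMod 2, (2 * if a ≠ 0 ∨ b ≠ 0 then 1 else 0) =
      (if a ≠ 0 then 1 else 0) + (if b ≠ 0 then 1 else 0) + if a + b ≠ 0 then 1 else 0 := by
    decide
  convert key (x i) (y i)

/-- Each coordinate in the joint support of `x, y, z` lies in the joint support of exactly six of
the seven two-dimensional subspaces of their span. -/
theorem six_mul_jointWt_triple {n : ℕ} (x y z : Fin n → ZMod 2) :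
    6 * jointWt [x, y, z] =
      jointWt [x, y] + jointWt [x, z] + jointWt [y, z] + jointWt [x, y + z] +
        jointWt [y, x + z] + jointWt [z, x + y] + jointWt [x + y, x + z] := by
  simp only [jointWt, Finset.card_filter, Finset.mul_sum, ← Finset.sum_add_distrib]
  refine Finset.sum_congr rfl fun i _ => ?_
  simp only [List.mem_cons, List.not_mem_nil, or_false, exists_eq_or_imp, exists_eq_left,
    Pi.add_apply]
  generalize x i = a, y i = b, z i = c
  revert a b c
  decide

/-- Each coordinate in the joint support of `x, y, z, t` lies in the joint support of exactly
fourteen of the fifteen three-dimensional subspaces of their span. -/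
theorem fourteen_mul_jointWt_quadruple {n : ℕ} (x y z t : Fin n → ZMod 2) :
    14 * jointWt [x, y, z, t] =
      jointWt [y, z, t] + jointWt [x, z, t] + jointWt [x + y, z, t] +
        jointWt [x, y, t] + jointWt [y, x + z, t] + jointWt [x, y + z, t] +
        jointWt [x + y, x + z, t] + jointWt [x, y, z] + jointWt [y, z, x + t] +
        jointWt [x, z, y + t] + jointWt [x + y, z, x + t] + jointWt [x, y, z + t] +
        jointWt [y, x + z, x + t] + jointWt [x, y + z, y + t] + jointWt [x + y, x + z, x + t] := by
  simp only [jointWt, Finset.card_filter, Finset.mul_sum, ← Finset.sum_add_distrib]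
  refine Finset.sum_congr rfl fun i _ => ?_
  simp only [List.mem_cons, List.not_mem_nil, or_false, exists_eq_or_imp, exists_eq_left,
    Pi.add_apply]
  generalize x i = a, y i = b, z i = c, t i = d
  revert a b c d
  decide +kernel

theorem add_add_add_left_cancel_zmod_two {m : ℕ} (u v w : Fin m → ZMod 2) :
    u + v + (u + w) = v + w := by
  ext i
  simp [add_add_add_comm, CharTwo.add_self_eq_zero]

section LowerBoundOnLength

variable {n m d e k : ℕ} {f : (Fin m → ZMod 2) →ₗ[ZMod 2] (Fin n → ZMod 2)}

theorem le_jointWt_pair (hf : ∀ u : Fin m → ZMod 2, u ≠ 0 → d ≤ wt (f u)) (he : 2 * e < 3 * d + 2)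
    (u v : Fin m → ZMod 2) (hu : u ≠ 0) (hv : v ≠ 0) (huv : u + v ≠ 0) :
    e ≤ jointWt [f u, f v] := by
  have h := two_mul_jointWt_pair (f u) (f v)
  rw [← map_add] at h
  have := hf u hu
  have := hf v hv
  have := hf _ huv
  lia

theorem le_jointWt_triple
    (hf : ∀ u v : Fin m → ZMod 2, u ≠ 0 → v ≠ 0 → u + v ≠ 0 → e ≤ jointWt [f u, f v])
    (hk : 6 * k < 7 * e + 6) (u v w : Fin m → ZMod 2)
    (h : u ≠ 0 ∧ v ≠ 0 ∧ w ≠ 0 ∧ u + v ≠ 0 ∧ u + w ≠ 0 ∧ v + w ≠ 0 ∧ u + v + w ≠ 0) :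
    k ≤ jointWt [f u, f v, f w] := by
  obtain ⟨hu, hv, hw, huv, huw, hvw, huvw⟩ := h
  have h := six_mul_jointWt_triple (f u) (f v) (f w)
  simp only [← map_add] at h
  have := hf u v hu hv huv
  have := hf u w hu hw huw
  have := hf v w hv hw hvw
  have := hf u (v + w) hu hvw (by rwa [← add_assoc])
  have := hf v (u + w) hv huw (by rwa [add_left_comm, ← add_assoc])
  have := hf w (u + v) hw huv (by rwa [add_comm])
  have := hf (u + v) (u + w) huv huw (by rwa [add_add_add_left_cancel_zmod_two])
  lia

end LowerBoundOnLength

theorem le_length_of_le_jointWt_triple {n k l : ℕ}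
    {f : (Fin 4 → ZMod 2) →ₗ[ZMod 2] (Fin n → ZMod 2)}
    (h : ∀ u v w : Fin 4 → ZMod 2,
      u ≠ 0 ∧ v ≠ 0 ∧ w ≠ 0 ∧ u + v ≠ 0 ∧ u + w ≠ 0 ∧ v + w ≠ 0 ∧ u + v + w ≠ 0 →
        k ≤ jointWt [f u, f v, f w])
    (hl : 14 * l < 15 * k + 14) : l ≤ n := by
  let e : Fin 4 → Fin 4 → ZMod 2 := fun i => Pi.single i 1
  have key := fourteen_mul_jointWt_quadruple (f (e 0)) (f (e 1)) (f (e 2)) (f (e 3))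
  have hn := jointWt_le [f (e 0), f (e 1), f (e 2), f (e 3)]
  simp only [← map_add] at key
  have h1 := h (e 1) (e 2) (e 3) (by decide)
  have h2 := h (e 0) (e 2) (e 3) (by decide)
  have h3 := h (e 0 + e 1) (e 2) (e 3) (by decide)
  have h4 := h (e 0) (e 1) (e 3) (by decide)
  have h5 := h (e 1) (e 0 + e 2) (e 3) (by decide)
  have h6 := h (e 0) (e 1 + e 2) (e 3) (by decide)
  have h7 := h (e 0 + e 1) (e 0 + e 2) (e 3) (by decide)
  have h8 := h (e 0) (e 1) (e 2) (by decide)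
  have h9 := h (e 1) (e 2) (e 0 + e 3) (by decide)
  have h10 := h (e 0) (e 2) (e 1 + e 3) (by decide)
  have h11 := h (e 0 + e 1) (e 2) (e 0 + e 3) (by decide)
  have h12 := h (e 0) (e 1) (e 2 + e 3) (by decide)
  have h13 := h (e 1) (e 0 + e 2) (e 0 + e 3) (by decide)
  have h14 := h (e 0) (e 1 + e 2) (e 1 + e 3) (by decide)
  have h15 := h (e 0 + e 1) (e 0 + e 2) (e 0 + e 3) (by decide)
  lia

/-- A special case of the Griesmer bound: the minimum weight of a four-dimensional code of one of
the given lengths stays strictly below the Plotkin bound. -/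
theorem minWt_lt_of_finrank_eq_four {n : ℕ}
    (h : n % 15 = 2 ∨ n % 15 = 3 ∨ n % 15 = 4 ∨ n % 15 = 6 ∨ n % 15 = 10)
    (C : Submodule (ZMod 2) (Fin n → ZMod 2)) (hC : Module.finrank (ZMod 2) C = 4) :
    minWt C < 8 * n / 15 := by
  by_contra! hd
  let φ : (Fin 4 → ZMod 2) ≃ₗ[ZMod 2] C := LinearEquiv.ofFinrankEq _ _ (by simp [hC])
  have hf : ∀ u, u ≠ 0 → 8 * n / 15 ≤ wt ((C.subtype ∘ₗ φ.toLinearMap) u) := fun u hu =>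
    hd.trans (Nat.sInf_le ⟨_, (φ u).2, by simpa using hu, rfl⟩)
  have h₂ := le_jointWt_pair (e := (3 * (8 * n / 15) + 1) / 2) hf (by lia)
  have h₃ := le_jointWt_triple (k := (7 * ((3 * (8 * n / 15) + 1) / 2) + 5) / 6) h₂ (by lia)
  have := le_length_of_le_jointWt_triple (l := n + 1) h₃ (by lia)
  lia

/-- The codeword map of the code whose generator matrix has the columns `g i`. -/
def encode {n m : ℕ} (g : Fin n → Fin m → ZMod 2) :
    (Fin m → ZMod 2) →ₗ[ZMod 2] (Fin n → ZMod 2) :=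
  LinearMap.pi fun i => ∑ j, g i j • LinearMap.proj j

theorem encode_apply {n m : ℕ} (g : Fin n → Fin m → ZMod 2) (u : Fin m → ZMod 2) (i : Fin n) :
    encode g u i = ∑ j, g i j * u j := by
  simp [encode]

/-- The columns `g i` generate an LCD code of full dimension and minimum weight at least `d`. -/
def GeneratesLCD {n m : ℕ} (g : Fin n → Fin m → ZMod 2) (d : ℕ) : Prop :=
  (∀ u : Fin m → ZMod 2, (∀ v : Fin m → ZMod 2,
      ∑ i, (∑ j, g i j * u j) * (∑ j, g i j * v j) = 0) → u = 0) ∧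
    ∀ u : Fin m → ZMod 2, u ≠ 0 →
      d ≤ Finset.card (Finset.univ.filter fun i => ∑ j, g i j * u j ≠ 0)

instance {n m : ℕ} (g : Fin n → Fin m → ZMod 2) (d : ℕ) : Decidable (GeneratesLCD g d) := by
  unfold GeneratesLCD
  infer_instance

theorem GeneratesLCD.exists_code {n m d : ℕ} [NeZero m] {g : Fin n → Fin m → ZMod 2}
    (hg : GeneratesLCD g d) :
    ∃ C : Submodule (ZMod 2) (Fin n → ZMod 2),
      Module.finrank (ZMod 2) C = m ∧ IsLCD C ∧ d ≤ minWt C := by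
  obtain ⟨hgram, hwt⟩ := hg
  simp only [← encode_apply] at hgram hwt
  have hinj : Function.Injective (encode g) := by
    rw [← LinearMap.ker_eq_bot, LinearMap.ker_eq_bot']
    intro u hu
    exact hgram u fun v => by simp [hu]
  refine ⟨(encode g).range, ?_, ?_, ?_⟩
  · simp [LinearMap.finrank_range_of_inj hinj]
  · rw [IsLCD, eq_bot_iff]
    rintro _ ⟨⟨u, rfl⟩, hx⟩
    have hu : u = 0 := hgram u fun v => hx _ ⟨v, rfl⟩
    simp [hu]
  · refine le_csInf ⟨_, encode g 1, ⟨1, rfl⟩, ?_, rfl⟩ ?_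
    · exact (map_ne_zero_iff _ hinj).2 one_ne_zero
    · rintro _ ⟨_, ⟨u, rfl⟩, hu, rfl⟩
      exact hwt u fun h => hu (by simp [h])

/-- The binary expansion of `a`, as a column of length four. -/
def bitColumn (a : ℕ) : Fin 4 → ZMod 2 :=
  fun j => if a.testBit j then 1 else 0

/-- The columns of a generator matrix of the simplex code of dimension four. -/
def simplexColumns : Fin 15 → Fin 4 → ZMod 2 :=
  fun i => bitColumn (i + 1)

theorem simplexColumns_selfOrthogonal : ∀ u v : Fin 4 → ZMod 2,
    ∑ i, (∑ j, simplexColumns i j * u j) * (∑ j, simplexColumns i j * v j) = 0 := by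
  decide +kernel

theorem simplexColumns_weight : ∀ u : Fin 4 → ZMod 2, u ≠ 0 →
    Finset.card (Finset.univ.filter fun i => ∑ j, simplexColumns i j * u j ≠ 0) = 8 := by
  decide +kernel

/-- Adjoining a simplex code keeps the Gram matrix and raises all nonzero weights by eight. -/
theorem GeneratesLCD.append_simplex {n d : ℕ} {g : Fin n → Fin 4 → ZMod 2}
    (hg : GeneratesLCD g d) : GeneratesLCD (Fin.append g simplexColumns) (d + 8) := by
  constructor
  · intro u hu
    refine hg.1 u fun v => ?_
    simpa [Fin.sum_univ_add, simplexColumns_selfOrthogonal] using hu v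
  · intro u hu
    have h₁ := hg.2 u hu
    have h₂ := simplexColumns_weight u hu
    simp only [Finset.card_filter] at h₁ h₂ ⊢
    rw [Fin.sum_univ_add]
    simp only [Fin.append_left, Fin.append_right]
    lia

theorem exists_generatesLCD_add {n d : ℕ} (h : ∃ g : Fin n → Fin 4 → ZMod 2, GeneratesLCD g d)
    (q : ℕ) : ∃ g : Fin (n + 15 * q) → Fin 4 → ZMod 2, GeneratesLCD g (d + 8 * q) := by
  induction q with
  | zero => exact h
  | succ q ih =>
    obtain ⟨g, hg⟩ := ih
    exact ⟨_, hg.append_simplex⟩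

theorem exists_generatesLCD {n : ℕ} (hn : 4 ≤ n)
    (h : n % 15 = 2 ∨ n % 15 = 3 ∨ n % 15 = 4 ∨ n % 15 = 6 ∨ n % 15 = 10) :
    ∃ g : Fin n → Fin 4 → ZMod 2, GeneratesLCD g (8 * n / 15 - 1) := by
  have extend : ∀ {r d : ℕ} {g : Fin r → Fin 4 → ZMod 2}, GeneratesLCD g d →
      r ≤ n → n % 15 = r % 15 → d = 8 * r / 15 - 1 → 2 ≤ 8 * r / 15 →
      ∃ g : Fin n → Fin 4 → ZMod 2, GeneratesLCD g (8 * n / 15 - 1) := by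
    intro r d g hg hr hmod hd hpos
    obtain ⟨q, rfl⟩ : ∃ q, n = r + 15 * q := ⟨(n - r) / 15, by lia⟩
    rw [show 8 * (r + 15 * q) / 15 - 1 = d + 8 * q by lia]
    exact exists_generatesLCD_add ⟨g, hg⟩ q
  have h17 : GeneratesLCD (fun i => bitColumn
      (![1, 1, 2, 3, 4, 5, 5, 7, 7, 8, 9, 10, 10, 11, 12, 13, 14] i)) 8 := by
    decide +kernel
  have h18 : GeneratesLCD (fun i => bitColumn
      (![1, 2, 2, 3, 4, 4, 5, 6, 7, 7, 8, 10, 11, 11, 12, 13, 14, 15] i)) 8 := by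
    decide +kernel
  have h4 : GeneratesLCD (fun i => bitColumn (![1, 2, 4, 8] i)) 1 := by
    decide +kernel
  have h6 : GeneratesLCD (fun i => bitColumn (![1, 5, 7, 9, 10, 13] i)) 2 := by
    decide +kernel
  have h10 : GeneratesLCD (fun i => bitColumn
      (![3, 6, 7, 8, 9, 10, 11, 12, 14, 15] i)) 4 := by
    decide +kernel
  rcases h with h | h | h | h | h
  · exact extend h17 (by lia) (by lia) (by lia) (by lia)
  · exact extend h18 (by lia) (by lia) (by lia) (by lia)
  · exact extend h4 (by lia) (by lia) (by lia) (by lia)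
  · exact extend h6 (by lia) (by lia) (by lia) (by lia)
  · exact extend h10 (by lia) (by lia) (by lia) (by lia)

theorem lcd_dim4_minusOne (n : ℕ) (hn : 4 ≤ n)
    (h : n % 15 = 2 ∨ n % 15 = 3 ∨ n % 15 = 4 ∨ n % 15 = 6 ∨ n % 15 = 10) :
    dLCD n 4 = 8 * n / 15 - 1 := by
  obtain ⟨g, hg⟩ := exists_generatesLCD hn h
  obtain ⟨C, hC, hlcd, hd⟩ := hg.exists_code
  have upper : ∀ d ∈ {d | ∃ C : Submodule (ZMod 2) (Fin n → ZMod 2),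
      Module.finrank (ZMod 2) C = 4 ∧ IsLCD C ∧ minWt C = d}, d ≤ 8 * n / 15 - 1 := by
    rintro _ ⟨D, hD, -, rfl⟩
    exact Nat.le_sub_one_of_lt (minWt_lt_of_finrank_eq_four h D hD)
  exact le_antisymm (csSup_le ⟨_, C, hC, hlcd, rfl⟩ upper)
    (le_csSup_of_le ⟨_, upper⟩ ⟨C, hC, hlcd, rfl⟩ hd)
end

section
/- There is no binary LCD [n,4,d] code for any of the parameter pairs (n,d) = (22,11), (23,12), (26,13), (27,14), (30,16), (30,15), (31,16); that is, for each such pair there exists no 4-dimensional linear complementary dual subspace of F_2^n whose minimum weight is d. -/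
open Finset

section Weight

variable {n : ℕ}

lemma zmod_two_ne_zero_iff (a : ZMod 2) : a ≠ 0 ↔ a = 1 := by
  revert a; decide

/-- The weight modulo two is the sum of the coordinates. -/
lemma sum_coords_eq_wt (x : Fin n → ZMod 2) : ∑ i, x i = (wt x : ZMod 2) := by
  rw [wt, Finset.card_filter, Nat.cast_sum]
  refine Finset.sum_congr rfl fun i _ => ?_
  generalize x i = a
  revert a; decide

lemma wt_add (x y : Fin n → ZMod 2) :
    wt (x + y) + 2 * wt (x * y) = wt x + wt y := by
  simp only [wt, Finset.card_filter, Finset.mul_sum, ← Finset.sum_add_distrib, Pi.add_apply,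
    Pi.mul_apply]
  refine Finset.sum_congr rfl fun i _ => ?_
  generalize x i = a
  generalize y i = b
  revert a b; decide

lemma wt_zero : wt (0 : Fin n → ZMod 2) = 0 := by simp [wt]

end Weight

section Fibers

variable {V : Type*} [AddCommGroup V] [Module (ZMod 2) V] [Fintype V]

/-- A fibre of a linear map is empty or a translate of the kernel. -/
lemma card_fiber_eq_zero_or {W : Type*} [AddCommGroup W] [Module (ZMod 2) W] [DecidableEq W]
    (L : V →ₗ[ZMod 2] W) (b : W) :
    #{u | L u = b} = 0 ∨ #{u | L u = b} = #{u | L u = 0} := by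
  rcases Finset.eq_empty_or_nonempty ({u | L u = b} : Finset V) with h | ⟨a, ha⟩
  · left; simp [h]
  · right
    have ha : L a = b := by simpa using ha
    refine Finset.card_bij (fun u _ => u - a) ?_ ?_ ?_
    · intro u hu
      have hu : L u = b := by simpa using hu
      simp [ha, hu]
    · intro u _ v _ h
      simpa using h
    · intro u hu
      have hu : L u = 0 := by simpa using hu
      exact ⟨u + a, by simp [ha, hu], by simp⟩

lemma two_pow_dvd_card_ker {W : Type*} [AddCommGroup W] [Module (ZMod 2) W] [DecidableEq W]
    [Module.Finite (ZMod 2) W] (L : V →ₗ[ZMod 2] W) {r : ℕ}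
    (h : r + Module.finrank (ZMod 2) W ≤ Module.finrank (ZMod 2) V) :
    2 ^ r ∣ #{u | L u = 0} := by
  have h1 : #{u | L u = 0} = Nat.card (LinearMap.ker L) := by
    rw [← Fintype.card_subtype, ← Nat.card_eq_fintype_card]
    rfl
  have h2 := Module.natCard_eq_pow_finrank (K := ZMod 2) (V := LinearMap.ker L)
  have h3 := L.finrank_range_add_finrank_ker
  have h4 := (LinearMap.range L).finrank_le
  rw [h1, h2, Nat.card_zmod]
  exact pow_dvd_pow 2 (by omega)

lemma card_eq_sixteen (hV : Module.finrank (ZMod 2) V = 4) : Fintype.card V = 16 := by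
  rw [Module.card_eq_pow_finrank (K := ZMod 2) (V := V), hV]; rfl

lemma card_functional_eq_one (hV : Module.finrank (ZMod 2) V = 4) (f : V →ₗ[ZMod 2] ZMod 2) :
    #{u | f u = 1} = 0 ∨ #{u | f u = 1} = 8 := by
  have hd := two_pow_dvd_card_ker f (r := 3) (by simp [hV])
  have hc := card_fiber_eq_zero_or f 1
  have hcard := card_eq_sixteen hV
  have hs : #{u | f u = 0} + #{u | f u = 1} = 16 := by
    rw [← hcard, ← Finset.card_univ,
      ← Finset.card_filter_add_card_filter_not (s := univ) (fun u => f u = 0)]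
    simp only [← ne_eq, zmod_two_ne_zero_iff]
  omega

lemma four_dvd_card_functionals (hV : Module.finrank (ZMod 2) V = 4)
    (f g : V →ₗ[ZMod 2] ZMod 2) (a b : ZMod 2) : 4 ∣ #{u | f u = a ∧ g u = b} := by
  have hd := two_pow_dvd_card_ker (f.prod g) (r := 2) (by simp [hV])
  have hc := card_fiber_eq_zero_or (f.prod g) (a, b)
  simp only [LinearMap.prod_apply, Function.prod, Prod.mk.injEq] at hc
  simp only [LinearMap.prod_apply, Function.prod] at hd
  rcases hc with hc | hc
  · simp [hc]
  · rw [hc]; exact hd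

lemma exists_ne_zero_functional_eq_zero (hV : Module.finrank (ZMod 2) V = 4)
    (g : V →ₗ[ZMod 2] ZMod 2) : ∃ x, x ≠ 0 ∧ g x = 0 := by
  have hd := two_pow_dvd_card_ker g (r := 3) (by simp [hV])
  have hpos : 0 < #{u | g u = 0} := Finset.card_pos.2 ⟨0, by simp⟩
  obtain ⟨x, hx, hx0⟩ := Finset.exists_mem_ne (Nat.lt_of_lt_of_le (by norm_num)
    (Nat.le_of_dvd hpos hd)) 0
  exact ⟨x, hx0, by simpa using hx⟩

end Fibers

section Multisets

variable {V : Type*} [AddCommGroup V] [Module (ZMod 2) V]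

/-- One of the three nonzero vectors spanned by two vectors lies in a given hyperplane. -/
lemma functional_eq_zero_or_or (g : V →ₗ[ZMod 2] ZMod 2) (a b : V) :
    g a = 0 ∨ g b = 0 ∨ g (a + b) = 0 := by
  rw [map_add]
  generalize g a = s
  generalize g b = t
  revert s t; decide

lemma add_eq_iff_eq_add_of_char_two (a b c : V) : a + b = c ↔ b = a + c := by
  constructor
  · rintro rfl
    rw [← add_assoc, ZModModule.add_self, zero_add]
  · rintro rfl
    rw [← add_assoc, ZModModule.add_self, zero_add]

variable [DecidableEq V]

lemma even_count_of_four {p q r : V}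
    (h0 : (0 : V) ∉ ({p, q, r, p + q + r} : Multiset V)) (y : V) :
    Even (Multiset.count (p + q) {p, q, r, p + q + r} + Multiset.count y {p, q, r, p + q + r} +
      Multiset.count (p + q + y) {p, q, r, p + q + r}) := by
  have hp : p + q + y = p ↔ y = q := by
    rw [add_eq_iff_eq_add_of_char_two, add_comm p q, add_assoc, ZModModule.add_self, add_zero]
  have hq : p + q + y = q ↔ y = p := by
    rw [add_eq_iff_eq_add_of_char_two, add_assoc, ZModModule.add_self, add_zero]
  have hr : p + q + y = r ↔ y = p + q + r := add_eq_iff_eq_add_of_char_two _ _ _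
  have hs : p + q + y = p + q + r ↔ y = r := add_right_inj _
  have hx : p + q ∉ ({p, q, r, p + q + r} : Multiset V) := by
    simp only [Multiset.insert_eq_cons, Multiset.mem_cons, Multiset.mem_singleton, not_or] at h0 ⊢
    obtain ⟨h1, h2, h3, h4⟩ := h0
    refine ⟨?_, ?_, ?_, ?_⟩
    · simpa using Ne.symm h2
    · simpa using Ne.symm h1
    · rintro rfl
      exact h4 (ZModModule.add_self _).symm
    · simpa using Ne.symm h3
  rw [Multiset.count_eq_zero_of_notMem hx]
  simp only [Multiset.insert_eq_cons, Multiset.count_cons, Multiset.count_singleton, hp, hq, hr, hs]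
  exact Nat.even_iff.2 (by omega)

lemma odd_count_of_three {p q y : V}
    (h0 : (0 : V) ∉ ({p, q, p + q} : Multiset V)) (hy : y ≠ 0) (hyp : y ≠ p) :
    Odd (Multiset.count p {p, q, p + q} + Multiset.count y {p, q, p + q} +
      Multiset.count (p + y) {p, q, p + q}) := by
  simp only [Multiset.insert_eq_cons, Multiset.mem_cons, Multiset.mem_singleton, not_or] at h0
  obtain ⟨h1, h2, h3⟩ := h0
  have hpq : p ≠ q := by
    rintro rfl
    exact h3 (ZModModule.add_self _).symm
  have hp : p + y = p ↔ y = 0 := by simp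
  have hq : p + y = q ↔ y = p + q := add_eq_iff_eq_add_of_char_two _ _ _
  have hs : p + y = p + q ↔ y = q := add_right_inj _
  have hpp : p ≠ p + q := by simpa using Ne.symm h2
  simp only [Multiset.insert_eq_cons, Multiset.count_cons, Multiset.count_singleton, hp, hq, hs,
    hy, hyp, hpq, hpp, if_true, if_false]
  exact ⟨(if y = p + q then 1 else 0) + (if y = q then 1 else 0), by ring⟩

/-- A zero-sum triple of nonzero vectors has odd total multiplicity on every line through a
suitable point of a given hyperplane. -/
lemma exists_odd_count (g : V →ₗ[ZMod 2] ZMod 2)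
    {M : Multiset V} (h0 : (0 : V) ∉ M) (hsum : M.sum = 0) (hM : M.card = 3) :
    ∃ x, x ≠ 0 ∧ g x = 0 ∧ ∀ y, y ≠ 0 → y ≠ x → Odd (M.count x + M.count y + M.count (x + y)) := by
  obtain ⟨p, q, r, hMr⟩ := Multiset.card_eq_three.1 hM
  have hr : r = p + q := by
    have h : p + q + r = 0 := by simpa [hMr, add_assoc] using hsum
    rw [add_eq_iff_eq_add_of_char_two] at h
    simpa using h
  subst hr
  have of_point (a b : V) (hMc : M = {a, b, a + b}) (hg : g a = 0) :
      ∃ x, x ≠ 0 ∧ g x = 0 ∧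
        ∀ y, y ≠ 0 → y ≠ x → Odd (M.count x + M.count y + M.count (x + y)) := by
    rw [hMc] at h0 ⊢
    exact ⟨a, fun h => h0 (by simp [h]), hg, fun y hy hya => odd_count_of_three h0 hy hya⟩
  rcases functional_eq_zero_or_or g p q with h | h | h
  · exact of_point p q hMr h
  · refine of_point q p ?_ h
    rw [hMr, add_comm q p]
    simp only [Multiset.insert_eq_cons]
    rw [Multiset.cons_swap p q]
  · refine of_point (p + q) p ?_ h
    rw [hMr, show p + q + p = q + (p + p) by abel, ZModModule.add_self, add_zero]
    simp only [Multiset.insert_eq_cons]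
    rw [Multiset.cons_swap (p + q) p]
    exact congrArg _ (Multiset.pair_comm _ _)

variable [Fintype V]

/-- A zero-sum multiset of `0`, `2` or `4` nonzero vectors has even total multiplicity on every
line through a suitable point of a given hyperplane. -/
lemma exists_even_count (hV : Module.finrank (ZMod 2) V = 4) (g : V →ₗ[ZMod 2] ZMod 2)
    {M : Multiset V} (h0 : (0 : V) ∉ M) (hsum : M.sum = 0)
    (hM : M.card = 0 ∨ M.card = 2 ∨ M.card = 4) :
    ∃ x, x ≠ 0 ∧ g x = 0 ∧ ∀ y, Even (M.count x + M.count y + M.count (x + y)) := by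
  obtain ⟨z, hz, hgz⟩ := exists_ne_zero_functional_eq_zero hV g
  have of_even (h : ∀ y, Even (M.count y)) :
      ∃ x, x ≠ 0 ∧ g x = 0 ∧ ∀ y, Even (M.count x + M.count y + M.count (x + y)) :=
    ⟨z, hz, hgz, fun y => ((h _).add (h _)).add (h _)⟩
  rcases hM with hM | hM | hM
  · rw [Multiset.card_eq_zero] at hM
    exact of_even (by simp [hM])
  · obtain ⟨p, q, rfl⟩ := Multiset.card_eq_two.1 hM
    have hpq : q = p := by
      have h : p + q = 0 := by simpa using hsum
      rw [add_eq_iff_eq_add_of_char_two] at h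
      simpa using h
    subst hpq
    refine of_even fun y => ?_
    simp only [Multiset.insert_eq_cons, Multiset.count_cons, Multiset.count_singleton]
    exact ⟨_, rfl⟩
  · obtain ⟨p, q, r, s, hMs⟩ := Multiset.card_eq_four.1 hM
    have hs : s = p + q + r := by
      have h : p + q + r + s = 0 := by simpa [hMs, add_assoc] using hsum
      rw [add_eq_iff_eq_add_of_char_two] at h
      simpa using h
    subst hs
    have of_pair (a b c : V) (hMc : M = {a, b, c, a + b + c}) (hg : g (a + b) = 0) :
        ∃ x, x ≠ 0 ∧ g x = 0 ∧ ∀ y, Even (M.count x + M.count y + M.count (x + y)) := by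
      by_cases hab : a = b
      · subst hab
        refine of_even fun y => ?_
        rw [ZModModule.add_self, zero_add] at hMc
        simp only [hMc, Multiset.insert_eq_cons, Multiset.count_cons, Multiset.count_singleton]
        exact Nat.even_iff.2 (by omega)
      · refine ⟨a + b, fun h => hab ?_, hg, fun y => ?_⟩
        · rw [add_eq_iff_eq_add_of_char_two, add_zero] at h
          exact h.symm
        · rw [hMc] at h0 ⊢
          exact even_count_of_four h0 y
    rcases functional_eq_zero_or_or g (p + q) (q + r) with h | h | h
    · exact of_pair p q r hMs h
    · refine of_pair q r p ?_ h
      rw [hMs, show q + r + p = p + q + r by abel]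
      simp only [Multiset.insert_eq_cons]
      rw [Multiset.cons_swap p q, Multiset.cons_swap p r]
    · refine of_pair p r q ?_ ?_
      · rw [hMs, show p + r + q = p + q + r by abel]
        simp only [Multiset.insert_eq_cons]
        rw [Multiset.cons_swap q r]
      · rwa [show p + q + (q + r) = p + r + (q + q) by abel, ZModModule.add_self, add_zero] at h

end Multisets

section Codes

variable {n : ℕ} (C : Submodule (ZMod 2) (Fin n → ZMod 2))

/-- The `j`-th coordinate as a functional on a code. -/
def coordForm (j : Fin n) : C →ₗ[ZMod 2] ZMod 2 :=
  LinearMap.proj j ∘ₗ C.subtype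

/-- The weight modulo two as a functional on a code. -/
def parityForm : C →ₗ[ZMod 2] ZMod 2 :=
  ∑ j, coordForm C j

lemma coordForm_apply (j : Fin n) (u : C) : coordForm C j u = (u : Fin n → ZMod 2) j := rfl

lemma parityForm_apply (u : C) : parityForm C u = (wt (u : Fin n → ZMod 2) : ZMod 2) := by
  simp [parityForm, coordForm_apply, sum_coords_eq_wt, LinearMap.sum_apply]

variable {C}

/-- The parity of the excess of the weight of a codeword over `d`. -/
def excessParity (d : ℕ) (u : C) : ℕ := (wt (u : Fin n → ZMod 2) + d) % 2

/-- Half of the excess of the weight of a codeword over `d`. -/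
def halfExcess (d : ℕ) (u : C) : ℕ := (wt (u : Fin n → ZMod 2) - d) / 2

lemma excessParity_eq_ite (d : ℕ) (u : C) :
    excessParity d u = if parityForm C u = d + 1 then 1 else 0 := by
  have h : parityForm C u = d + 1 ↔ (wt (u : Fin n → ZMod 2) + d) % 2 = 1 := by
    rw [parityForm_apply]
    have := ZMod.natCast_eq_natCast_iff (wt (u : Fin n → ZMod 2)) (d + 1) 2
    push_cast at this
    rw [this, Nat.ModEq]
    omega
  rw [excessParity]
  split_ifs with h' <;> rw [h] at h' <;> omega

lemma wt_eq_of_le {d : ℕ} {u : C} (h : d ≤ wt (u : Fin n → ZMod 2)) :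
    wt (u : Fin n → ZMod 2) = d + excessParity d u + 2 * halfExcess d u := by
  rw [excessParity, halfExcess]
  omega

/-- A nonzero even word `x` with `wt x + wt y ≡ wt (x + y)` modulo `4` for all `y` lies in the
dual code. -/
lemma not_isLCD_of_four_dvd {x : C} (hx : x ≠ 0) (hpar : parityForm C x = 0)
    (h : ∀ y : C, y ≠ 0 → y ≠ x →
      (wt (x : Fin n → ZMod 2) + wt (y : Fin n → ZMod 2)) % 4 =
        wt ((x + y : C) : Fin n → ZMod 2) % 4) : ¬ IsLCD C := by
  intro hL
  refine hx (Subtype.ext ?_)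
  rw [IsLCD, Submodule.eq_bot_iff] at hL
  refine hL x ⟨x.2, fun y hy => ?_⟩
  rw [show ∑ i, (x : Fin n → ZMod 2) i * y i = ∑ i, ((x : Fin n → ZMod 2) * y) i from rfl]
  rw [sum_coords_eq_wt]
  rcases eq_or_ne y 0 with rfl | hy0
  · simp [wt_zero]
  rcases eq_or_ne y x with rfl | hyx
  · rw [parityForm_apply] at hpar
    rw [show (x : Fin n → ZMod 2) * x = x from funext fun i => ?_, hpar]
    rw [Pi.mul_apply]
    generalize (x : Fin n → ZMod 2) i = a
    revert a; decide
  · have h1 := h ⟨y, hy⟩ (fun e => hy0 (congrArg Subtype.val e))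
      (fun e => hyx (congrArg Subtype.val e))
    have h2 := wt_add (x : Fin n → ZMod 2) y
    rw [ZMod.natCast_eq_zero_iff_even, Nat.even_iff]
    simp only [Submodule.coe_add] at h1
    omega

lemma not_isLCD_of_halfExcess {d : ℕ} (hd : ∀ u : C, u ≠ 0 → d ≤ wt (u : Fin n → ZMod 2))
    {x : C} (hx : x ≠ 0) (hpar : parityForm C x = 0)
    (h : ∀ y : C, y ≠ 0 → y ≠ x →
      4 ∣ d + d % 2 + 2 * (halfExcess d x + halfExcess d y + halfExcess d (x + y))) :
    ¬ IsLCD C := by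
  refine not_isLCD_of_four_dvd hx hpar fun y hy hyx => ?_
  have hxy : x + y ≠ 0 := by
    rw [ne_eq, add_eq_iff_eq_add_of_char_two, add_zero]
    exact hyx
  have h1 := wt_eq_of_le (hd x hx)
  have h2 := wt_eq_of_le (hd y hy)
  have h3 := wt_eq_of_le (hd _ hxy)
  have h4 := h y hy hyx
  have h5 := excessParity_eq_ite d y
  have h6 := excessParity_eq_ite d (x + y)
  rw [map_add, hpar, zero_add, ← h5] at h6
  have h7 : excessParity d x = d % 2 := by
    rw [parityForm_apply, ZMod.natCast_eq_zero_iff_even, Nat.even_iff] at hpar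
    rw [excessParity]
    omega
  omega

variable [Fintype C]

lemma sum_wt_filter (P : C → Prop) [DecidablePred P] :
    ∑ u : C with P u, wt (u : Fin n → ZMod 2) = ∑ i, #{u : C | P u ∧ coordForm C i u = 1} := by
  simp only [wt, Finset.card_filter]
  rw [Finset.sum_comm]
  refine Finset.sum_congr rfl fun i _ => ?_
  rw [Finset.sum_filter]
  refine Finset.sum_congr rfl fun u _ => ?_
  simp only [zmod_two_ne_zero_iff, coordForm_apply]
  split_ifs <;> simp_all

/-- The total weight of a four-dimensional code is eight times its effective length. -/
lemma exists_sum_wt_eq (hC : Module.finrank (ZMod 2) C = 4) :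
    ∃ N ≤ n, ∑ u : C, wt (u : Fin n → ZMod 2) = 8 * N := by
  classical
  refine ⟨#{i | #{u : C | coordForm C i u = 1} = 8}, ?_, ?_⟩
  · simpa using Finset.card_le_univ {i : Fin n | #{u : C | coordForm C i u = 1} = 8}
  · have h := sum_wt_filter (C := C) (fun _ => True)
    simp only [Finset.filter_true, true_and] at h
    rw [h, Finset.card_filter, Finset.mul_sum]
    refine Finset.sum_congr rfl fun i _ => ?_
    rcases card_functional_eq_one hC (coordForm C i) with h | h <;> simp [h]

lemma four_dvd_sum_wt (hC : Module.finrank (ZMod 2) C = 4) (j : Fin n) :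
    4 ∣ ∑ u : C with coordForm C j u = 1, wt (u : Fin n → ZMod 2) := by
  rw [sum_wt_filter]
  exact Finset.dvd_sum fun i _ => four_dvd_card_functionals hC _ _ _ _

lemma sum_excessParity (hC : Module.finrank (ZMod 2) C = 4) (d : ℕ) :
    (Even d ∧ (∑ u : C, excessParity d u = 0 ∨ ∑ u : C, excessParity d u = 8)) ∨
    (Odd d ∧ (∑ u : C, excessParity d u = 8 ∨ ∑ u : C, excessParity d u = 16)) := by
  have hs : ∑ u : C, excessParity d u = #{u : C | parityForm C u = d + 1} := by
    simp only [excessParity_eq_ite, Finset.card_filter]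
  have h1 := card_functional_eq_one hC (parityForm C)
  have hcard := card_eq_sixteen hC
  rw [hs]
  rcases Nat.even_or_odd d with hd | hd
  · left
    rw [(ZMod.natCast_eq_zero_iff_even).2 hd, zero_add]
    exact ⟨hd, h1⟩
  · right
    have h2 := Finset.card_filter_add_card_filter_not (s := (univ : Finset C))
      (fun u => parityForm C u = 0)
    simp only [← ne_eq, zmod_two_ne_zero_iff, Finset.card_univ, hcard] at h2
    rw [(ZMod.natCast_eq_one_iff_odd).2 hd, show (1 + 1 : ZMod 2) = 0 from rfl]
    exact ⟨hd, by omega⟩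

lemma sum_wt_eq (hC : Module.finrank (ZMod 2) C = 4) {d : ℕ}
    (hd : ∀ u : C, u ≠ 0 → d ≤ wt (u : Fin n → ZMod 2)) :
    ∑ u : C, wt (u : Fin n → ZMod 2) + d % 2 =
      15 * d + ∑ u : C, excessParity d u + 2 * ∑ u : C, halfExcess d u := by
  classical
  have hcard := card_eq_sixteen hC
  have h : ∑ u : C, (wt (u : Fin n → ZMod 2) + if u = 0 then d + d % 2 else 0) =
      ∑ u : C, (d + excessParity d u + 2 * halfExcess d u) := by
    refine Finset.sum_congr rfl fun u _ => ?_
    split_ifs with hu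
    · subst hu
      simp [excessParity, halfExcess, wt_zero]
    · rw [add_zero, ← wt_eq_of_le (hd u hu)]
  simp only [Finset.sum_add_distrib, ← Finset.mul_sum, Finset.sum_ite_eq', Finset.mem_univ,
    if_true, Finset.sum_const, Finset.card_univ, hcard, smul_eq_mul] at h
  omega

lemma even_sum_halfExcess (hC : Module.finrank (ZMod 2) C = 4) {d : ℕ}
    (hd : ∀ u : C, u ≠ 0 → d ≤ wt (u : Fin n → ZMod 2)) (j : Fin n) :
    Even (∑ u : C with coordForm C j u = 1, halfExcess d u) := by
  have h : ∑ u : C with coordForm C j u = 1, wt (u : Fin n → ZMod 2) =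
      ∑ u : C with coordForm C j u = 1, (d + excessParity d u + 2 * halfExcess d u) := by
    refine Finset.sum_congr rfl fun u hu => wt_eq_of_le (hd u ?_)
    rintro rfl
    simp at hu
  have hw := four_dvd_sum_wt hC j
  have he : 4 ∣ ∑ u : C with coordForm C j u = 1, excessParity d u := by
    simp only [excessParity_eq_ite]
    rw [← Finset.card_filter, Finset.filter_filter]
    exact four_dvd_card_functionals hC _ _ _ _
  have hc : 4 ∣ #{u : C | coordForm C j u = 1} * d := by
    rcases card_functional_eq_one hC (coordForm C j) with h | h <;> rw [h] <;> omega
  simp only [Finset.sum_add_distrib, ← Finset.mul_sum, Finset.sum_const, smul_eq_mul] at h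
  rw [Nat.even_iff]
  omega

/-- The multiset of codewords in which a word occurs with multiplicity half its excess weight. -/
def excessMultiset (C : Submodule (ZMod 2) (Fin n → ZMod 2)) [Fintype C] (d : ℕ) : Multiset C :=
  ∑ u : C, Multiset.replicate (halfExcess d u) u

lemma count_excessMultiset [DecidableEq C] (d : ℕ) (u : C) :
    (excessMultiset C d).count u = halfExcess d u := by
  simp [excessMultiset, Multiset.count_sum', Multiset.count_replicate]

lemma card_excessMultiset (d : ℕ) :
    (excessMultiset C d).card = ∑ u : C, halfExcess d u := by
  simp [excessMultiset]

lemma zero_notMem_excessMultiset (d : ℕ) : (0 : C) ∉ excessMultiset C d := by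
  classical
  rw [← Multiset.count_eq_zero, count_excessMultiset]
  simp [halfExcess, wt_zero]

lemma sum_excessMultiset (hC : Module.finrank (ZMod 2) C = 4) {d : ℕ}
    (hd : ∀ u : C, u ≠ 0 → d ≤ wt (u : Fin n → ZMod 2)) :
    (excessMultiset C d).sum = 0 := by
  have h : (excessMultiset C d).sum = ∑ u : C, halfExcess d u • u := by
    rw [excessMultiset, ← Multiset.coe_sumAddMonoidHom, map_sum]
    simp
  rw [h]
  ext j
  rw [← coordForm_apply, map_sum]
  have he := (ZMod.natCast_eq_zero_iff_even).2 (even_sum_halfExcess hC hd j)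
  rw [Nat.cast_sum, Finset.sum_filter] at he
  simp only [ZeroMemClass.coe_zero, Pi.zero_apply]
  rw [← he]
  refine Finset.sum_congr rfl fun u _ => ?_
  rw [map_nsmul, nsmul_eq_mul]
  rcases eq_or_ne (coordForm C j u) 0 with h | h
  · simp [h]
  · simp [(zmod_two_ne_zero_iff _).1 h]

end Codes

theorem no_lcd_dim4_codes (n d : ℕ)
    (h : (n, d) = (22, 11) ∨ (n, d) = (23, 12) ∨ (n, d) = (26, 13) ∨ (n, d) = (27, 14) ∨
      (n, d) = (30, 16) ∨ (n, d) = (30, 15) ∨ (n, d) = (31, 16)) :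
    ¬ ∃ C : Submodule (ZMod 2) (Fin n → ZMod 2),
      Module.finrank (ZMod 2) C = 4 ∧ IsLCD C ∧ minWt C = d := by
  rintro ⟨C, hC, hL, hmin⟩
  classical
  have hd (u : C) (hu : u ≠ 0) : d ≤ wt (u : Fin n → ZMod 2) := by
    rw [← hmin]
    exact Nat.sInf_le ⟨u, u.2, fun e => hu (Subtype.ext e), rfl⟩
  have : Fintype C := Fintype.ofFinite C
  obtain ⟨N, hN, hsum⟩ := exists_sum_wt_eq hC
  have htotal := sum_wt_eq hC hd
  have hparity := sum_excessParity hC d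
  rw [Nat.even_iff, Nat.odd_iff] at hparity
  rw [hsum, ← card_excessMultiset] at htotal
  have h0 := zero_notMem_excessMultiset (C := C) d
  have hs := sum_excessMultiset hC hd
  simp only [Prod.mk.injEq] at h
  have hcases : ((d + d % 2) % 4 = 0 ∧ ((excessMultiset C d).card = 0 ∨
      (excessMultiset C d).card = 2 ∨ (excessMultiset C d).card = 4)) ∨
      ((d + d % 2) % 4 = 2 ∧ (excessMultiset C d).card = 3) := by
    generalize (excessMultiset C d).card = K at *
    generalize ∑ u : C, excessParity d u = T at *
    rcases h with h | h | h | h | h | h | h <;> obtain ⟨rfl, rfl⟩ := h <;> omega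
  rcases hcases with ⟨hd4, hK⟩ | ⟨hd4, hK⟩
  · obtain ⟨x, hx, hpar, hcount⟩ := exists_even_count hC (parityForm C) h0 hs hK
    refine not_isLCD_of_halfExcess hd hx hpar (fun y _ _ => ?_) hL
    have hy := hcount y
    simp only [count_excessMultiset, Nat.even_iff] at hy
    omega
  · obtain ⟨x, hx, hpar, hcount⟩ := exists_odd_count (parityForm C) h0 hs hK
    refine not_isLCD_of_halfExcess hd hx hpar (fun y hy hyx => ?_) hL
    have hy := hcount y hy hyx
    simp only [count_excessMultiset, Nat.odd_iff] at hy
    omega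
end

section
/- If n ≥ 5 and n ≡ 12 (mod 31), then the largest minimum weight d(n,5) among all binary LCD [n,5] codes satisfies d(n,5) = ⌊16n/31⌋ − 2 or d(n,5) = ⌊16n/31⌋ − 3. -/
/-- The character `a ↦ (-1)^a` of `ZMod 2`. -/
def sgn (a : ZMod 2) : ℤ := if a = 0 then 1 else -1

theorem sgn_add (a b : ZMod 2) : sgn (a + b) = sgn a * sgn b := by
  revert a b; decide

theorem two_mul_ite_ne_zero (a : ZMod 2) : 2 * (if a ≠ 0 then 1 else 0 : ℤ) = 1 - sgn a := by
  revert a; decide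

theorem sum_sgn_dotProduct (p : Fin 5 → ZMod 2) :
    ∑ y, sgn (p ⬝ᵥ y) = if p = 0 then 32 else 0 := by
  split_ifs with hp
  · simp only [hp, zero_dotProduct, sgn, if_true, Finset.sum_const, Finset.card_univ,
      Fintype.card_fun, ZMod.card, Fintype.card_fin]
    norm_num
  · obtain ⟨j, hj⟩ := Function.ne_iff.mp hp
    have hj1 : p j = 1 := by
      have : ∀ a : ZMod 2, a ≠ 0 → a = 1 := by decide
      exact this _ hj
    have hshift := Equiv.sum_comp (Equiv.addRight (Pi.single j 1 : Fin 5 → ZMod 2))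
      (fun y => sgn (p ⬝ᵥ y))
    simp only [Equiv.coe_addRight] at hshift
    have hneg : ∀ y, sgn (p ⬝ᵥ (y + Pi.single j 1)) = -sgn (p ⬝ᵥ y) := by
      intro y
      rw [dotProduct_add, sgn_add, dotProduct_single, hj1]
      simp [sgn]
    simp only [hneg, Finset.sum_neg_distrib] at hshift
    linarith

theorem sum_dotProduct_sgn (y : Fin 5 → ZMod 2) :
    ∑ p : Fin 5 → ZMod 2, sgn (p ⬝ᵥ y) = if y = 0 then 32 else 0 := by
  rw [← sum_sgn_dotProduct]
  exact Finset.sum_congr rfl fun p _ => by rw [dotProduct_comm]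

theorem add_eq_zero_iff_eq_of_zmod_two {y z : Fin 5 → ZMod 2} : y + z = 0 ↔ y = z := by
  rw [add_eq_zero_iff_eq_neg, CharTwo.neg_eq]

theorem sum_fourier (g : (Fin 5 → ZMod 2) → ℤ) :
    ∑ p, ∑ y, g y * sgn (p ⬝ᵥ y) = 32 * g 0 := by
  rw [Finset.sum_comm]
  simp_rw [← Finset.mul_sum, sum_dotProduct_sgn]
  simp [mul_comm]

theorem parseval (g : (Fin 5 → ZMod 2) → ℤ) :
    ∑ p, (∑ y, g y * sgn (p ⬝ᵥ y)) ^ 2 = 32 * ∑ y, g y ^ 2 := by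
  have hexp : ∀ p, (∑ y, g y * sgn (p ⬝ᵥ y)) ^ 2
      = ∑ y, ∑ z, g y * g z * sgn (p ⬝ᵥ (y + z)) := by
    intro p
    rw [sq, Finset.sum_mul_sum]
    refine Finset.sum_congr rfl fun y _ => Finset.sum_congr rfl fun z _ => ?_
    rw [dotProduct_add, sgn_add]
    ring
  simp_rw [hexp]
  rw [Finset.sum_comm, Finset.mul_sum]
  refine Finset.sum_congr rfl fun y _ => ?_
  rw [Finset.sum_comm]
  simp_rw [← Finset.mul_sum, sum_dotProduct_sgn,
    add_eq_zero_iff_eq_of_zmod_two]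
  simp
  ring

theorem fifteen_le_sum_sq (g : (Fin 5 → ZMod 2) → ℤ) (h0 : g 0 = 0)
    (hG : ∀ p, (8 : ℤ) ∣ (∑ y, g y * sgn (p ⬝ᵥ y)) - 3) : 15 ≤ ∑ y, g y ^ 2 := by
  have hpos : ∀ p, 0 ≤ (∑ y, g y * sgn (p ⬝ᵥ y)) ^ 2
      + 2 * (∑ y, g y * sgn (p ⬝ᵥ y)) - 15 := by
    intro p
    obtain ⟨k, hk⟩ := hG p
    rw [eq_add_of_sub_eq hk]
    rcases le_or_gt 0 k with hk0 | hk0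
    · nlinarith
    · nlinarith
  have hsum := Finset.sum_nonneg fun p (_ : p ∈ Finset.univ) => hpos p
  rw [Finset.sum_sub_distrib, Finset.sum_add_distrib, ← Finset.mul_sum, parseval, sum_fourier,
    h0] at hsum
  simp at hsum
  linarith

theorem odd_indicator_le {g : ℤ} (hg : 0 ≤ g) : (if Even g then 0 else 1 : ℤ) ≤ g := by
  split_ifs with he
  · exact hg
  · rcases hg.eq_or_lt with h | h
    · exact absurd (h ▸ Even.zero) he
    · exact h

theorem sum_odd_indicator_le (g : (Fin 5 → ZMod 2) → ℤ) (hg : ∀ y, 0 ≤ g y)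
    (hsum : ∑ y, g y ≤ 11) (hsq : 15 ≤ ∑ y, g y ^ 2) :
    ∑ y, (if Even (g y) then 0 else 1 : ℤ) ≤ 9 := by
  obtain ⟨z, hz⟩ : ∃ z, 2 ≤ g z := by
    by_contra! hlt
    have : ∑ y, g y ^ 2 ≤ ∑ y, g y :=
      Finset.sum_le_sum fun y _ => by nlinarith [hg y, hlt y]
    linarith
  have hz2 : 2 ≤ g z - (if Even (g z) then 0 else 1 : ℤ) := by
    split_ifs with he
    · linarith
    · rcases hz.eq_or_lt with h | h
      · exact absurd (h ▸ even_two) he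
      · linarith
  have hle := Finset.single_le_sum (f := fun y => g y - (if Even (g y) then 0 else 1 : ℤ))
    (fun y _ => sub_nonneg.mpr (odd_indicator_le (hg y))) (Finset.mem_univ z)
  simp only [Finset.sum_sub_distrib] at hle
  linarith

section Columns

variable {ι : Type*} [Fintype ι] (c : ι → Fin 5 → ZMod 2)

/-- The weight of the codeword indexed by `y` in the code with columns `c`. -/
def colWt (y : Fin 5 → ZMod 2) : ℕ := ∑ i, if c i ⬝ᵥ y ≠ 0 then 1 else 0

/-- The Gram form of the code with columns `c`. -/
def colForm (u y : Fin 5 → ZMod 2) : ZMod 2 := ∑ i, (c i ⬝ᵥ u) * (c i ⬝ᵥ y)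

theorem two_mul_sum_colWt_mul_sgn (p : Fin 5 → ZMod 2) :
    2 * ∑ y, (colWt c y : ℤ) * sgn (p ⬝ᵥ y)
      = ∑ i, ((if p = 0 then 32 else 0) - (if p = c i then 32 else 0)) := by
  simp only [colWt, Nat.cast_sum, Finset.sum_mul]
  rw [Finset.sum_comm, Finset.mul_sum]
  refine Finset.sum_congr rfl fun i _ => ?_
  have hterm : ∀ y, 2 * (((if c i ⬝ᵥ y ≠ 0 then 1 else 0 : ℕ) : ℤ) * sgn (p ⬝ᵥ y))
      = sgn (p ⬝ᵥ y) - sgn ((p + c i) ⬝ᵥ y) := by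
    intro y
    rw [← mul_assoc, Nat.cast_ite, Nat.cast_one, Nat.cast_zero, two_mul_ite_ne_zero,
      add_dotProduct, sgn_add]
    ring
  rw [Finset.mul_sum, Finset.sum_congr rfl fun y _ => hterm y, Finset.sum_sub_distrib,
    sum_sgn_dotProduct, sum_sgn_dotProduct]
  simp only [add_eq_zero_iff_eq_of_zmod_two]

theorem sixteen_dvd_sum_colWt_mul_sgn (p : Fin 5 → ZMod 2) :
    (16 : ℤ) ∣ ∑ y, (colWt c y : ℤ) * sgn (p ⬝ᵥ y) := by
  have h32 : (32 : ℤ) ∣ 2 * ∑ y, (colWt c y : ℤ) * sgn (p ⬝ᵥ y) := by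
    rw [two_mul_sum_colWt_mul_sgn]
    refine Finset.dvd_sum fun i _ => dvd_sub ?_ ?_ <;> split_ifs <;> simp
  omega

theorem sum_colWt_le : ∑ y, (colWt c y : ℤ) ≤ 16 * Fintype.card ι := by
  have h := two_mul_sum_colWt_mul_sgn c 0
  have hle : ∑ i, ((32 : ℤ) - (if 0 = c i then 32 else 0)) ≤ ∑ _i : ι, (32 : ℤ) :=
    Finset.sum_le_sum fun i _ => by split_ifs <;> norm_num
  simp only [zero_dotProduct, if_true, sgn, mul_one] at h
  rw [← h] at hle
  simp only [Finset.sum_const, Finset.card_univ, nsmul_eq_mul] at hle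
  linarith

theorem colForm_eq_dotProduct (u y : Fin 5 → ZMod 2) :
    colForm c u y = (∑ i, (c i ⬝ᵥ u) • c i) ⬝ᵥ y := by
  simp [colForm, sum_dotProduct, smul_dotProduct]

theorem colForm_add_left (u v y : Fin 5 → ZMod 2) :
    colForm c (u + v) y = colForm c u y + colForm c v y := by
  simp [colForm, dotProduct_add, add_mul, Finset.sum_add_distrib]

theorem colWt_add (u y : Fin 5 → ZMod 2) :
    ∃ k : ℕ, colWt c (u + y) + 2 * k = colWt c u + colWt c y ∧ (k : ZMod 2) = colForm c u y := by
  refine ⟨∑ i, if c i ⬝ᵥ u ≠ 0 ∧ c i ⬝ᵥ y ≠ 0 then 1 else 0, ?_, ?_⟩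
  · simp only [colWt, Finset.mul_sum, ← Finset.sum_add_distrib]
    refine Finset.sum_congr rfl fun i _ => ?_
    rw [dotProduct_add]
    generalize c i ⬝ᵥ u = a
    generalize c i ⬝ᵥ y = b
    revert a b
    decide
  · simp only [colForm, Nat.cast_sum]
    refine Finset.sum_congr rfl fun i _ => ?_
    generalize c i ⬝ᵥ u = a
    generalize c i ⬝ᵥ y = b
    revert a b
    decide

theorem neg_one_pow_eq_sgn (k : ℕ) : (-1 : ℤ) ^ k = sgn (k : ZMod 2) := by
  unfold sgn
  split_ifs with h
  · exact (ZMod.natCast_eq_zero_iff_even.mp h).neg_one_pow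
  · exact (Nat.not_even_iff_odd.mp (mt ZMod.natCast_eq_zero_iff_even.mpr h)).neg_one_pow

theorem sq_sum_neg_one_pow_half_colWt_le (h : (Fin 5 → ZMod 2) → ℕ)
    (hh : ∀ y, 2 * h y = colWt c y) :
    (∑ y, (-1 : ℤ) ^ h y) ^ 2
      ≤ 32 * (Finset.univ.filter fun u => ∀ y, colForm c u y = 0).card := by
  have hmul : ∀ u y, (-1 : ℤ) ^ h y * (-1) ^ h (u + y) = (-1) ^ h u * sgn (colForm c u y) := by
    intro u y
    obtain ⟨k, hk, hkf⟩ := colWt_add c u y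
    rw [← hh, ← hh, ← hh] at hk
    have hk' : h u + h y = h (u + y) + k := by omega
    have hsq : ∀ m : ℕ, (-1 : ℤ) ^ m * (-1) ^ m = 1 := fun m => by
      rw [← mul_pow]; simp
    rw [← hkf, ← neg_one_pow_eq_sgn]
    have e1 : (-1 : ℤ) ^ h u * (-1) ^ h y = (-1) ^ h (u + y) * (-1) ^ k := by
      rw [← pow_add, ← pow_add, hk']
    linear_combination -((-1 : ℤ) ^ k * (-1) ^ h y) * e1
      + (-1 : ℤ) ^ k * (-1) ^ h u * hsq (h y) - (-1 : ℤ) ^ h y * (-1) ^ h (u + y) * hsq k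
  have hrow : ∀ u, ∑ y, sgn (colForm c u y) = if ∀ y, colForm c u y = 0 then 32 else 0 := by
    intro u
    simp_rw [colForm_eq_dotProduct c u]
    rw [sum_sgn_dotProduct]
    simp only [dotProduct_eq_zero_iff]
  have hshift : ∀ y, ∑ z, (-1 : ℤ) ^ h z = ∑ u, (-1 : ℤ) ^ h (u + y) := fun y =>
    (Equiv.sum_comp (Equiv.addRight y) fun z => (-1 : ℤ) ^ h z).symm
  calc (∑ y, (-1 : ℤ) ^ h y) ^ 2
      = ∑ y, ∑ u, (-1 : ℤ) ^ h y * (-1) ^ h (u + y) := by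
        rw [sq, Finset.sum_mul]
        refine Finset.sum_congr rfl fun y _ => ?_
        rw [hshift y, Finset.mul_sum]
    _ = ∑ u, (-1 : ℤ) ^ h u * (if ∀ y, colForm c u y = 0 then 32 else 0) := by
        rw [Finset.sum_comm]
        refine Finset.sum_congr rfl fun u _ => ?_
        rw [← hrow u, Finset.mul_sum]
        exact Finset.sum_congr rfl fun y _ => hmul u y
    _ ≤ ∑ u, (if ∀ y, colForm c u y = 0 then 32 else 0) := by
        refine Finset.sum_le_sum fun u _ => ?_
        split_ifs
        · rcases neg_one_pow_eq_or ℤ (h u) with e | e <;> rw [e] <;> norm_num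
        · simp
    _ = 32 * (Finset.univ.filter fun u => ∀ y, colForm c u y = 0).card := by
        rw [← Finset.sum_filter]
        simp [mul_comm]

/-- An even code with parameters `[31 s + 13, 5, 16 s + 6]` has a hull of dimension at least two. -/
theorem two_lt_card_radical (s : ℕ) (h : (Fin 5 → ZMod 2) → ℕ)
    (hh : ∀ y, 2 * h y = colWt c y) (hcard : Fintype.card ι = 31 * s + 13)
    (hmin : ∀ y, y ≠ 0 → 8 * s + 3 ≤ h y) :
    2 < (Finset.univ.filter fun u => ∀ y, colForm c u y = 0).card := by
  have hzero : h 0 = 0 := by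
    have := hh 0
    simp [colWt] at this
    exact this
  set g : (Fin 5 → ZMod 2) → ℤ :=
    fun y => (h y : ℤ) - (8 * s + 3) + (if y = 0 then (8 * s + 3 : ℤ) else 0) with hgdef
  have hg0 : g 0 = 0 := by simp [hgdef, hzero]
  have hgne : ∀ y, y ≠ 0 → g y = (h y : ℤ) - (8 * s + 3) := fun y hy => by simp [hgdef, hy]
  have hgnn : ∀ y, 0 ≤ g y := by
    intro y
    by_cases hy : y = 0
    · rw [hy, hg0]
    · rw [hgne y hy]
      have := hmin y hy
      omega
  have hhZ : ∀ y, (colWt c y : ℤ) = 2 * h y := fun y => by rw [← hh]; push_cast; rfl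
  have hgsum : ∑ y, g y ≤ 11 := by
    have hle := sum_colWt_le c
    simp_rw [hhZ, ← Finset.mul_sum, hcard] at hle
    simp only [hgdef, Finset.sum_add_distrib, Finset.sum_sub_distrib]
    simp
    push_cast at hle
    linarith
  have hG : ∀ p, (8 : ℤ) ∣ (∑ y, g y * sgn (p ⬝ᵥ y)) - 3 := by
    intro p
    have hdvd := sixteen_dvd_sum_colWt_mul_sgn c p
    simp_rw [hhZ, mul_assoc, ← Finset.mul_sum] at hdvd
    have hexp : ∑ y, g y * sgn (p ⬝ᵥ y) = ∑ y, (h y : ℤ) * sgn (p ⬝ᵥ y)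
        - (8 * s + 3) * (if p = 0 then 32 else 0) + (8 * s + 3) := by
      rw [← sum_sgn_dotProduct, Finset.mul_sum, ← Finset.sum_sub_distrib]
      have : ((8 : ℤ) * s + 3) = ∑ y, (if y = 0 then (8 * s + 3 : ℤ) else 0) * sgn (p ⬝ᵥ y) := by
        simp only [ite_mul, zero_mul, Finset.sum_ite_eq', Finset.mem_univ, if_true,
          dotProduct_zero]
        simp [sgn]
      conv_rhs => rw [add_comm]; arg 1; rw [this]
      rw [← Finset.sum_add_distrib]
      refine Finset.sum_congr rfl fun y _ => ?_
      simp only [hgdef]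
      ring
    rw [hexp]
    split_ifs <;> omega
  have hodd := sum_odd_indicator_le g hgnn hgsum (fifteen_le_sum_sq g hg0 hG)
  have hW : ∑ y, (-1 : ℤ) ^ h y ≤ -12 := by
    have hle : ∀ y, (-1 : ℤ) ^ h y
        = -1 + 2 * (if Even (g y) then 0 else 1 : ℤ) + (if y = 0 then 2 else 0) := by
      intro y
      by_cases hy : y = 0
      · subst hy
        simp [hzero, hg0]
      · rw [hgne y hy]
        rcases Nat.even_or_odd (h y) with he | ho
        · have : ¬ Even ((h y : ℤ) - (8 * s + 3)) := by
            rw [Int.even_iff]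
            obtain ⟨k, hk⟩ := he
            omega
          simp [he.neg_one_pow, this, hy]
        · have : Even ((h y : ℤ) - (8 * s + 3)) := by
            rw [Int.even_iff]
            obtain ⟨k, hk⟩ := ho
            omega
          simp [ho.neg_one_pow, this, hy]
    simp_rw [hle, Finset.sum_add_distrib, ← Finset.mul_sum]
    have hcardV : ∑ _y : Fin 5 → ZMod 2, (-1 : ℤ) = -32 := by simp
    rw [hcardV, Finset.sum_ite_eq' Finset.univ]
    simp only [Finset.mem_univ, if_true]
    linarith
  have hsq := sq_sum_neg_one_pow_half_colWt_le c h hh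
  by_contra! hcon
  have : ((Finset.univ.filter fun u => ∀ y, colForm c u y = 0).card : ℤ) ≤ 2 := by
    exact_mod_cast hcon
  nlinarith

end Columns

section Upper

variable {n : ℕ}

/-- The columns `c` together with a parity check column. -/
def extendCol (c : Fin n → Fin 5 → ZMod 2) (o : Option (Fin n)) : Fin 5 → ZMod 2 :=
  o.elim (∑ i, c i) c

theorem colWt_extendCol (c : Fin n → Fin 5 → ZMod 2) (y : Fin 5 → ZMod 2) :
    colWt (extendCol c) y = (if (∑ i, c i) ⬝ᵥ y ≠ 0 then 1 else 0) + colWt c y := by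
  rw [colWt, Fintype.sum_option]
  rfl

theorem colForm_extendCol (c : Fin n → Fin 5 → ZMod 2) (u y : Fin 5 → ZMod 2) :
    colForm (extendCol c) u y = ((∑ i, c i) ⬝ᵥ u) * ((∑ i, c i) ⬝ᵥ y) + colForm c u y := by
  simp only [colForm, Fintype.sum_option, extendCol, Option.elim]

theorem natCast_ite_ne_zero (a : ZMod 2) : ((if a ≠ 0 then 1 else 0 : ℕ) : ZMod 2) = a := by
  revert a; decide

theorem even_colWt_extendCol (c : Fin n → Fin 5 → ZMod 2) (y : Fin 5 → ZMod 2) :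
    Even (colWt (extendCol c) y) := by
  rw [← ZMod.natCast_eq_zero_iff_even, colWt_extendCol, Nat.cast_add, natCast_ite_ne_zero,
    colWt, Nat.cast_sum]
  simp only [natCast_ite_ne_zero, sum_dotProduct]
  exact CharTwo.add_self_eq_zero _

/-- A code with parameters `[31 s + 12, 5, 16 s + 5]` has a nontrivial hull. -/
theorem exists_ne_zero_colForm_eq_zero (c : Fin n → Fin 5 → ZMod 2) (s : ℕ)
    (hn : n = 31 * s + 12) (hmin : ∀ y, y ≠ 0 → 16 * s + 5 ≤ colWt c y) :
    ∃ u, u ≠ 0 ∧ ∀ y, colForm c u y = 0 := by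
  have hcard := two_lt_card_radical (extendCol c) s (fun y => colWt (extendCol c) y / 2)
    (fun y => Nat.mul_div_cancel' (even_colWt_extendCol c y).two_dvd) (by simp [hn])
    (fun y hy => by
      have h1 := hmin y hy
      have h2 := colWt_extendCol c y
      have h3 := even_colWt_extendCol c y
      rw [Nat.even_iff] at h3
      omega)
  obtain ⟨a, ha, b, hb, hab, heq⟩ := Finset.exists_ne_map_eq_of_card_lt_of_maps_to
    (t := (Finset.univ : Finset (ZMod 2))) (f := fun u => (∑ i, c i) ⬝ᵥ u)
    (by simpa using hcard) (fun _ _ => Finset.mem_coe.mpr (Finset.mem_univ _))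
  simp only [Finset.mem_filter, Finset.mem_univ, true_and] at ha hb
  refine ⟨a + b, fun h => hab (add_eq_zero_iff_eq_of_zmod_two.mp h), fun y => ?_⟩
  have hform := colForm_add_left (extendCol c) a b y
  rw [ha, hb, colForm_extendCol, dotProduct_add, heq, CharTwo.add_self_eq_zero] at hform
  simpa using hform

theorem wt_mulVec (c : Fin n → Fin 5 → ZMod 2) (y : Fin 5 → ZMod 2) :
    wt (Matrix.mulVecLin (Matrix.of c) y) = colWt c y := by
  simp only [wt, Finset.card_filter, colWt]
  rfl

theorem exists_columns (C : Submodule (ZMod 2) (Fin n → ZMod 2))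
    (hC : Module.finrank (ZMod 2) C = 5) :
    ∃ c : Fin n → Fin 5 → ZMod 2, Function.Injective (Matrix.mulVecLin (Matrix.of c)) ∧
      LinearMap.range (Matrix.mulVecLin (Matrix.of c)) = C := by
  let b := Module.finBasisOfFinrankEq (ZMod 2) C hC
  have hcol : Matrix.mulVecLin (Matrix.of fun i j => (b j : Fin n → ZMod 2) i)
      = C.subtype ∘ₗ b.equivFun.symm.toLinearMap := by
    ext y i
    simp [Matrix.mulVec, dotProduct, Module.Basis.equivFun_symm_apply, Pi.single_apply]
  refine ⟨fun i j => (b j : Fin n → ZMod 2) i, ?_, ?_⟩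
  · rw [hcol]
    exact C.subtype_injective.comp b.equivFun.symm.injective
  · rw [hcol, LinearMap.range_comp, LinearEquiv.range, Submodule.map_top, Submodule.range_subtype]

theorem minWt_le_of_isLCD (C : Submodule (ZMod 2) (Fin n → ZMod 2)) (s : ℕ)
    (hn : n = 31 * s + 12) (hC : Module.finrank (ZMod 2) C = 5) (hLCD : IsLCD C) :
    minWt C ≤ 16 * s + 4 := by
  by_contra! hlt
  obtain ⟨c, hinj, rfl⟩ := exists_columns C hC
  obtain ⟨u, hu, hrad⟩ := exists_ne_zero_colForm_eq_zero c s hn fun y hy => by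
    rw [← wt_mulVec]
    refine le_trans hlt (Nat.sInf_le ⟨_, LinearMap.mem_range_self _ y, ?_, rfl⟩)
    exact (map_ne_zero_iff _ hinj).mpr hy
  have hmem : Matrix.mulVecLin (Matrix.of c) u ∈ LinearMap.range (Matrix.mulVecLin (Matrix.of c)) ⊓
      dualCode (LinearMap.range (Matrix.mulVecLin (Matrix.of c))) := by
    refine ⟨LinearMap.mem_range_self _ u, ?_⟩
    rintro _ ⟨y, rfl⟩
    exact hrad y
  rw [hLCD, Submodule.mem_bot] at hmem
  exact hu ((map_eq_zero_iff _ hinj).mp hmem)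

end Upper

section Lower

/-- The vector of the five lowest binary digits of `k`. -/
def bitVec (k : ℕ) : Fin 5 → ZMod 2 := fun j => if k.testBit j then 1 else 0

/-- The columns, as binary numerals, of an LCD code with parameters `[12, 5]`. -/
def baseNum (i : ℕ) : ℕ := [1, 2, 4, 8, 16, 5, 19, 28, 26, 25, 3, 9].getD i 0

/-- The columns, as binary numerals, of the base code followed by copies of the simplex code. -/
def colNum (i : ℕ) : ℕ := if i < 12 then baseNum i else i % 31 + 1

theorem sum_range_colNum {M : Type*} [AddCommMonoid M] (F : ℕ → M) (s : ℕ) :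
    ∑ i ∈ Finset.range (31 * s + 12), F (colNum i)
      = ∑ i ∈ Finset.range 12, F (baseNum i) + s • ∑ k ∈ Finset.range 31, F (k + 1) := by
  induction s with
  | zero =>
    rw [zero_smul, add_zero]
    refine Finset.sum_congr rfl fun i hi => ?_
    rw [colNum, if_pos (by simpa using hi)]
  | succ s ih =>
    have hcol : ∀ j, colNum (31 * s + 12 + j) = (12 + j) % 31 + 1 := by
      intro j
      rw [colNum, if_neg (by omega)]
      omega
    have hcycle : ∑ j ∈ Finset.range 31, F ((12 + j) % 31 + 1)
        = ∑ k ∈ Finset.range 31, F (k + 1) := by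
      refine Finset.sum_bij' (fun j _ => (12 + j) % 31) (fun k _ => (k + 19) % 31) ?_ ?_ ?_ ?_ ?_
      · intro j _; simp only [Finset.mem_range]; omega
      · intro j _; simp only [Finset.mem_range]; omega
      · intro j hj; simp only [Finset.mem_range] at hj; omega
      · intro j hj; simp only [Finset.mem_range] at hj; omega
      · intro j _; rfl
    rw [show 31 * (s + 1) + 12 = 31 * s + 12 + 31 by ring, Finset.sum_range_add, ih,
      Finset.sum_congr rfl fun j _ => congrArg F (hcol j), hcycle, succ_nsmul, add_assoc]

theorem simplex_weight : ∀ y : Fin 5 → ZMod 2, y ≠ 0 →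
    ∑ k ∈ Finset.range 31, (if bitVec (k + 1) ⬝ᵥ y ≠ 0 then 1 else 0) = 16 := by
  decide +kernel

theorem simplex_form_single : ∀ (u : Fin 5 → ZMod 2) (j : Fin 5),
    ∑ k ∈ Finset.range 31, (bitVec (k + 1) ⬝ᵥ u) * bitVec (k + 1) j = 0 := by
  decide +kernel

theorem simplex_form (u y : Fin 5 → ZMod 2) :
    ∑ k ∈ Finset.range 31, (bitVec (k + 1) ⬝ᵥ u) * (bitVec (k + 1) ⬝ᵥ y) = 0 := by
  have hexp : ∀ k, (bitVec (k + 1) ⬝ᵥ u) * (bitVec (k + 1) ⬝ᵥ y)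
      = ∑ j, (bitVec (k + 1) ⬝ᵥ u) * bitVec (k + 1) j * y j := fun k => by
    simp only [dotProduct, Finset.mul_sum, mul_assoc]
  simp_rw [hexp]
  rw [Finset.sum_comm]
  simp_rw [← Finset.sum_mul, simplex_form_single, zero_mul, Finset.sum_const_zero]

theorem base_weight : ∀ y : Fin 5 → ZMod 2, y ≠ 0 →
    3 ≤ ∑ i ∈ Finset.range 12, (if bitVec (baseNum i) ⬝ᵥ y ≠ 0 then 1 else 0) := by
  decide +kernel

theorem base_form_nondegenerate : ∀ u : Fin 5 → ZMod 2, u ≠ 0 → ∃ y : Fin 5 → ZMod 2,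
    ∑ i ∈ Finset.range 12, (bitVec (baseNum i) ⬝ᵥ u) * (bitVec (baseNum i) ⬝ᵥ y) ≠ 0 := by
  decide +kernel

theorem exists_isLCD_le_minWt (s : ℕ) :
    ∃ C : Submodule (ZMod 2) (Fin (31 * s + 12) → ZMod 2),
      Module.finrank (ZMod 2) C = 5 ∧ IsLCD C ∧ 16 * s + 3 ≤ minWt C := by
  set c : Fin (31 * s + 12) → Fin 5 → ZMod 2 := fun i => bitVec (colNum i)
  have hwt : ∀ y, y ≠ 0 → 16 * s + 3 ≤ colWt c y := by
    intro y hy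
    have hsum := sum_range_colNum (fun k => if bitVec k ⬝ᵥ y ≠ 0 then 1 else 0) s
    rw [simplex_weight y hy, smul_eq_mul] at hsum
    have hbase := base_weight y hy
    rw [colWt, Fin.sum_univ_eq_sum_range
      (fun i => if bitVec (colNum i) ⬝ᵥ y ≠ 0 then 1 else 0), hsum]
    omega
  have hform : ∀ u, u ≠ 0 → ∃ y, colForm c u y ≠ 0 := by
    intro u hu
    obtain ⟨y, hy⟩ := base_form_nondegenerate u hu
    refine ⟨y, ?_⟩
    have hsum := sum_range_colNum (fun k => (bitVec k ⬝ᵥ u) * (bitVec k ⬝ᵥ y)) s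
    rw [simplex_form u y, smul_zero, add_zero] at hsum
    rwa [colForm, Fin.sum_univ_eq_sum_range
      (fun i => (bitVec (colNum i) ⬝ᵥ u) * (bitVec (colNum i) ⬝ᵥ y)), hsum]
  have hinj : Function.Injective (Matrix.mulVecLin (Matrix.of c)) := by
    rw [injective_iff_map_eq_zero]
    intro y hy
    by_contra hne
    have := hwt y hne
    rw [← wt_mulVec, hy] at this
    simp [wt] at this
  refine ⟨LinearMap.range (Matrix.mulVecLin (Matrix.of c)), ?_, ?_, ?_⟩
  · rw [LinearMap.finrank_range_of_inj hinj, Module.finrank_fin_fun]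
  · rw [IsLCD, eq_bot_iff]
    rintro _ ⟨⟨u, rfl⟩, hdual⟩
    by_contra hne
    have hu : u ≠ 0 := by
      rintro rfl
      simp at hne
    obtain ⟨y, hy⟩ := hform u hu
    exact hy (hdual _ (LinearMap.mem_range_self _ y))
  · refine le_csInf ?_ ?_
    · exact ⟨_, _, LinearMap.mem_range_self _ 1, (map_ne_zero_iff _ hinj).mpr one_ne_zero, rfl⟩
    · rintro _ ⟨_, ⟨y, rfl⟩, hne, rfl⟩
      rw [wt_mulVec]
      refine hwt y ?_
      rintro rfl
      simp at hne

end Lower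

theorem lcd_dim5_twoValues'' (n : ℕ) (hn : 5 ≤ n) (h : n % 31 = 12) :
    dLCD n 5 = 16 * n / 31 - 2 ∨ dLCD n 5 = 16 * n / 31 - 3 := by
  obtain ⟨s, rfl⟩ : ∃ s, n = 31 * s + 12 := ⟨n / 31, by omega⟩
  have hub : ∀ d ∈ {d | ∃ C : Submodule (ZMod 2) (Fin (31 * s + 12) → ZMod 2),
      Module.finrank (ZMod 2) C = 5 ∧ IsLCD C ∧ minWt C = d}, d ≤ 16 * s + 4 := by
    rintro d ⟨C, hC, hLCD, rfl⟩
    exact minWt_le_of_isLCD C s rfl hC hLCD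
  obtain ⟨C, hC, hLCD, hmin⟩ := exists_isLCD_le_minWt s
  have hle : dLCD (31 * s + 12) 5 ≤ 16 * s + 4 := csSup_le ⟨_, C, hC, hLCD, rfl⟩ hub
  have hge : minWt C ≤ dLCD (31 * s + 12) 5 := le_csSup ⟨_, hub⟩ ⟨C, hC, hLCD, rfl⟩
  omega
end

section
/- The largest minimum weight among all binary LCD [17,8] codes equals 6; that is, there exists an 8-dimensional linear complementary dual subspace of F_2^17 with minimum weight 6, and no such subspace has minimum weight 7 or larger. -/
open Finset in
/-- In any coordinate, at most half of the words of a binary linear code are nonzero. -/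
lemma two_mul_card_coord_ne_zero_le {n : ℕ} (D : Submodule (ZMod 2) (Fin n → ZMod 2))
    [DecidablePred (· ∈ D)] (i : Fin n) :
    2 * #{x | x ∈ D ∧ x i ≠ 0} ≤ #{x | x ∈ D} := by
  have hle : #{x | x ∈ D ∧ x i ≠ 0} ≤ #{x | x ∈ D ∧ x i = 0} := by
    rcases eq_empty_or_nonempty ({x | x ∈ D ∧ x i ≠ 0} : Finset (Fin n → ZMod 2))
      with h | ⟨y, hy⟩
    · simp [h]
    · simp only [mem_filter, mem_univ, true_and] at hy
      refine card_le_card_of_injOn (· + y) ?_ (add_left_injective y).injOn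
      intro x hx
      simp only [coe_filter, mem_univ, true_and, Set.mem_ofPred_eq] at hx ⊢
      refine ⟨D.add_mem hx.1 hy.1, ?_⟩
      have key : ∀ a b : ZMod 2, a ≠ 0 → b ≠ 0 → a + b = 0 := by decide
      exact key _ _ hx.2 hy.2
  have hsplit := card_filter_add_card_filter_not
    (s := ({x | x ∈ D} : Finset (Fin n → ZMod 2))) (fun x => x i = 0)
  simp only [filter_filter] at hsplit
  simp only [ne_eq] at hle ⊢
  omega

open Finset in
/-- Averaging the weight over a binary linear code whose words are supported on `s`. -/
lemma two_mul_sum_wt_le {n : ℕ} (D : Submodule (ZMod 2) (Fin n → ZMod 2))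
    [DecidablePred (· ∈ D)] (s : Finset (Fin n)) (hs : ∀ x ∈ D, ∀ i ∉ s, x i = 0) :
    2 * ∑ x with x ∈ D, wt x ≤ #s * #{x | x ∈ D} := by
  have hwt : ∀ x ∈ ({x | x ∈ D} : Finset (Fin n → ZMod 2)),
      wt x = ∑ i ∈ s, if x i ≠ 0 then 1 else 0 := by
    intro x hx
    rw [mem_filter] at hx
    rw [← card_filter, wt]
    congr 1
    ext i
    simp only [mem_filter, mem_univ, true_and]
    exact ⟨fun h => ⟨by_contra fun hi => h (hs x hx.2 i hi), h⟩, fun h => h.2⟩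
  rw [sum_congr rfl hwt, sum_comm, mul_sum, ← smul_eq_mul #s]
  refine sum_le_card_nsmul _ _ _ fun i _ => ?_
  rw [← card_filter, filter_filter]
  exact two_mul_card_coord_ne_zero_le D i

lemma even_wt_of_sum_eq_zero {n : ℕ} {x : Fin n → ZMod 2} (hx : ∑ i, x i = 0) :
    Even (wt x) := by
  rw [← ZMod.natCast_eq_zero_iff_even, wt, Finset.card_filter, Nat.cast_sum]
  have key : ∀ a : ZMod 2, ((if a ≠ 0 then 1 else 0 : ℕ) : ZMod 2) = a := by decide
  exact (Finset.sum_congr rfl fun i _ => key _).trans hx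

open Finset in
/-- The Plotkin bound for linear codes of length `2 * d - 1` and minimum weight at least `d`. -/
lemma card_le_of_support_of_le_wt {n d : ℕ} (D : Submodule (ZMod 2) (Fin n → ZMod 2))
    [DecidablePred (· ∈ D)] (s : Finset (Fin n)) (hs : ∀ x ∈ D, ∀ i ∉ s, x i = 0)
    (hcard : #s + 1 ≤ 2 * d) (hd : ∀ x ∈ D, x ≠ 0 → d ≤ wt x) :
    #{x | x ∈ D} ≤ 2 * d := by
  have hupper := two_mul_sum_wt_le D s hs
  have hlower : #(({x | x ∈ D} : Finset (Fin n → ZMod 2)).erase 0) * d ≤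
      ∑ x with x ∈ D, wt x := by
    refine le_trans ?_ (sum_le_sum_of_subset (erase_subset 0 _))
    rw [← smul_eq_mul]
    refine card_nsmul_le_sum _ _ _ fun x hx => ?_
    simp only [mem_erase, mem_filter, mem_univ, true_and] at hx
    exact hd x hx.2 hx.1
  have herase := card_erase_add_one
    (show (0 : Fin n → ZMod 2) ∈ ({x | x ∈ D} : Finset (Fin n → ZMod 2)) by simp)
  nlinarith

lemma le_wt_of_le_minWt {n d : ℕ} {C : Submodule (ZMod 2) (Fin n → ZMod 2)}
    (h : d ≤ minWt C) {x : Fin n → ZMod 2} (hx : x ∈ C) (hx0 : x ≠ 0) : d ≤ wt x :=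
  h.trans (Nat.sInf_le ⟨x, hx, hx0, rfl⟩)

/-- The coordinate sum together with the first two coordinates. -/
def parityAndHead : (Fin 17 → ZMod 2) →ₗ[ZMod 2] (Fin 3 → ZMod 2) :=
  LinearMap.pi ![∑ i, LinearMap.proj i, LinearMap.proj 0, LinearMap.proj 1]

lemma mem_ker_parityAndHead {x : Fin 17 → ZMod 2} (hx : x ∈ LinearMap.ker parityAndHead) :
    ∑ i, x i = 0 ∧ x 0 = 0 ∧ x 1 = 0 := by
  rw [LinearMap.mem_ker] at hx
  refine ⟨?_, ?_, ?_⟩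
  · simpa [parityAndHead] using congrFun hx 0
  · simpa [parityAndHead] using congrFun hx 1
  · simpa [parityAndHead] using congrFun hx 2

/-- A binary `[17, 8]` code has minimum weight at most `6`: otherwise its even-weight subcode
shortened at two coordinates violates the Plotkin bound. -/
lemma minWt_le_six (C : Submodule (ZMod 2) (Fin 17 → ZMod 2))
    (hC : Module.finrank (ZMod 2) C = 8) : minWt C ≤ 6 := by
  classical
  by_contra! hmin
  set K := LinearMap.ker parityAndHead with hK
  have hdim : 5 ≤ Module.finrank (ZMod 2) (C ⊓ K : Submodule (ZMod 2) (Fin 17 → ZMod 2)) := by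
    have hsum := Submodule.finrank_sup_add_finrank_inf_eq C K
    have hsup := Submodule.finrank_le (C ⊔ K)
    have hker := LinearMap.finrank_range_add_finrank_ker parityAndHead
    have hrange := Submodule.finrank_le (LinearMap.range parityAndHead)
    simp only [Module.finrank_fin_fun] at hsup hker hrange
    rw [← hK] at hker
    omega
  have hplotkin := card_le_of_support_of_le_wt (d := 8) (C ⊓ K) {0, 1}ᶜ
    (fun x hx i hi => by
      obtain ⟨-, h0, h1⟩ := mem_ker_parityAndHead hx.2
      simp only [Finset.mem_compl, not_not, Finset.mem_insert, Finset.mem_singleton] at hi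
      rcases hi with rfl | rfl <;> assumption)
    (by decide)
    (fun x hx hx0 => by
      have h7 : 7 ≤ wt x := le_wt_of_le_minWt hmin hx.1 hx0
      obtain ⟨m, hm⟩ := even_wt_of_sum_eq_zero (mem_ker_parityAndHead hx.2).1
      omega)
  rw [← Fintype.card_subtype] at hplotkin
  have hcard := Module.card_eq_pow_finrank (K := ZMod 2)
    (V := (C ⊓ K : Submodule (ZMod 2) (Fin 17 → ZMod 2)))
  rw [ZMod.card] at hcard
  have hpow := Nat.pow_le_pow_right (n := 2) (by norm_num) hdim
  have heq : Fintype.card {x // x ∈ C ⊓ K} = 2 ^ Module.finrank (ZMod 2)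
      (C ⊓ K : Submodule (ZMod 2) (Fin 17 → ZMod 2)) := by
    rw [← hcard]
  omega

/-- The vector of the lowest `n` binary digits of `m`. -/
def bits (n m : ℕ) : Fin n → ZMod 2 := fun i => (m.testBit i).toNat

lemma bits_xor (n l m : ℕ) : bits n (l ^^^ m) = bits n l + bits n m := by
  funext i
  have key : ∀ b c : Bool, (((b ^^ c).toNat : ℕ) : ZMod 2) = b.toNat + c.toNat := by decide
  simp only [bits, Nat.testBit_xor, Pi.add_apply, key]

lemma bits_val_mul (n m : ℕ) : ∀ c : ZMod 2, bits n (c.val * m) = c • bits n m := by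
  have h0 : bits n ((0 : ZMod 2).val * m) = (0 : ZMod 2) • bits n m := by
    funext i; simp [bits]
  have h1 : bits n ((1 : ZMod 2).val * m) = (1 : ZMod 2) • bits n m := by
    simp [ZMod.val_one]
  intro c
  fin_cases c
  exacts [h0, h1]

lemma wt_bits (n m : ℕ) : wt (bits n m) = ∑ i : Fin n, (m.testBit i).toNat := by
  have key : ∀ b : Bool, (if (b.toNat : ZMod 2) ≠ 0 then 1 else 0) = b.toNat := by decide
  rw [wt, Finset.card_filter]
  exact Finset.sum_congr rfl fun i _ => key _

/-- Generator matrix of an LCD `[17, 8, 6]` code; each row is given by the number whose binary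
digits, lowest first, are its coordinates. -/
def genMatrix : Matrix (Fin 8) (Fin 17) (ZMod 2) :=
  Matrix.of ![bits 17 28161,
    bits 17 123138,
    bits 17 48900,
    bits 17 129544,
    bits 17 72976,
    bits 17 22304,
    bits 17 52544,
    bits 17 95360]

/-- Inverse of the Gram matrix of `genMatrix`. -/
def gramInv : Matrix (Fin 8) (Fin 8) (ZMod 2) :=
  !![0, 1, 1, 1, 0, 0, 1, 0;
     1, 0, 0, 0, 0, 1, 1, 0;
     1, 0, 0, 0, 1, 0, 1, 1;
     1, 0, 0, 0, 1, 0, 0, 0;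
     0, 0, 1, 1, 0, 1, 0, 1;
     0, 1, 0, 0, 1, 0, 1, 1;
     1, 1, 1, 0, 0, 1, 0, 1;
     0, 0, 1, 0, 1, 1, 1, 0]

lemma gram_mul_gramInv : genMatrix * genMatrix.transpose * gramInv = 1 := by
  decide +kernel

/-- The code generated by the rows of `genMatrix`. -/
def code : Submodule (ZMod 2) (Fin 17 → ZMod 2) :=
  LinearMap.range genMatrix.vecMulLinear

lemma vecMul_genMatrix (a : Fin 8 → ZMod 2) :
    Matrix.vecMul a genMatrix = bits 17
      ((a 0).val * 28161 ^^^ (a 1).val * 123138 ^^^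
       (a 2).val * 48900 ^^^ (a 3).val * 129544 ^^^
       (a 4).val * 72976 ^^^ (a 5).val * 22304 ^^^
       (a 6).val * 52544 ^^^ (a 7).val * 95360) := by
  rw [Matrix.vecMul_eq_sum, Fin.sum_univ_eight]
  simp only [bits_xor, bits_val_mul]
  rfl

lemma six_le_wt_vecMul : ∀ a : Fin 8 → ZMod 2, a ≠ 0 → 6 ≤ wt (Matrix.vecMul a genMatrix) := by
  simp only [vecMul_genMatrix, wt_bits]
  decide +kernel

lemma finrank_code : Module.finrank (ZMod 2) code = 8 := by
  have hinj : Function.Injective genMatrix.vecMulLinear := by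
    rw [injective_iff_map_eq_zero]
    intro a ha
    by_contra h
    have h6 := six_le_wt_vecMul a h
    rw [← Matrix.vecMulLinear_apply, ha] at h6
    simp [wt] at h6
  rw [code, LinearMap.finrank_range_of_inj hinj, Module.finrank_fin_fun]

lemma isLCD_code : IsLCD code := by
  rw [IsLCD, eq_bot_iff]
  rintro _ ⟨⟨a, rfl⟩, hdual⟩
  have hgram : Matrix.vecMul a (genMatrix * genMatrix.transpose) = 0 := by
    rw [← Matrix.vecMul_vecMul]
    funext j
    have hj := hdual (genMatrix j) ⟨Pi.single j 1, by simp [Matrix.row]⟩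
    simpa [Matrix.vecMul, dotProduct] using hj
  have ha : a = 0 := by
    rw [← Matrix.vecMul_one a, ← gram_mul_gramInv, ← Matrix.vecMul_vecMul, hgram,
      Matrix.zero_vecMul]
  simp [ha]

lemma minWt_code : minWt code = 6 := by
  have hrow : wt (Matrix.vecMul (Pi.single 0 1) genMatrix) = 6 := by decide +kernel
  have hrow0 : Matrix.vecMul (Pi.single 0 1) genMatrix ≠ 0 := by decide +kernel
  refine le_antisymm (Nat.sInf_le ⟨_, ⟨Pi.single 0 1, rfl⟩, hrow0, hrow⟩) ?_
  refine le_csInf ⟨6, _, ⟨Pi.single 0 1, rfl⟩, hrow0, hrow⟩ ?_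
  rintro _ ⟨_, ⟨a, rfl⟩, hne, rfl⟩
  exact six_le_wt_vecMul a fun h => hne (by simp [h])

theorem lcd_17_8 :
    (∃ C : Submodule (ZMod 2) (Fin 17 → ZMod 2),
      Module.finrank (ZMod 2) C = 8 ∧ IsLCD C ∧ minWt C = 6) ∧
    (∀ C : Submodule (ZMod 2) (Fin 17 → ZMod 2),
      Module.finrank (ZMod 2) C = 8 → IsLCD C → minWt C ≤ 6) := by
  exact ⟨⟨code, finrank_code, isLCD_code, minWt_code⟩, fun C hC _ => minWt_le_six C hC⟩
end
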